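/- Let α > β > 2, a, b > 0, and f(r) = a r^{-α} - b r^{-β}. If L₀ is a two-dimensional lattice that is a global minimizer of E_f among all two-dimensional lattices (i.e., E_f[L₀] ≤ E_f[L] for every lattice L), then the co-volume V_{L₀} of L₀ satisfies 0 < V_{L₀} ≤ (a α / (b β))^{2/(α-β)}. -/

import Mathlib

noncomputable section

/-- A point of the Euclidean plane with coordinates `a`, `b`. -/
def vec2 (a b : ℝ) : EuclideanSpace ℝ (Fin 2) := (WithLp.equiv 2 (Fin 2 → ℝ)).symm ![a, b]

/-- The lattice (as a set of points) generated by `u` and `v`. -/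
def latticeSet (u v : EuclideanSpace ℝ (Fin 2)) : Set (EuclideanSpace ℝ (Fin 2)) :=
  {p | ∃ m n : ℤ, p = (m : ℝ) • u + (n : ℝ) • v}

/-- The determinant of the pair of plane vectors `(u, v)`. -/
def det2 (u v : EuclideanSpace ℝ (Fin 2)) : ℝ := u 0 * v 1 - u 1 * v 0

/-- `L` is a two-dimensional lattice, i.e. `L = ℤu ⊕ ℤv` for a basis `(u,v)` of ℝ². -/
def IsLattice2 (L : Set (EuclideanSpace ℝ (Fin 2))) : Prop :=
  ∃ u v : EuclideanSpace ℝ (Fin 2), det2 u v ≠ 0 ∧ L = latticeSet u v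

/-- `L` is a two-dimensional lattice of co-volume `V = |det(u,v)|`. -/
def IsLattice2OfCovol (L : Set (EuclideanSpace ℝ (Fin 2))) (V : ℝ) : Prop :=
  ∃ u v : EuclideanSpace ℝ (Fin 2), det2 u v ≠ 0 ∧ |det2 u v| = V ∧ L = latticeSet u v

/-- The Epstein zeta function of a set of points: `ζ_L(s) = Σ'_{p ∈ L, p ≠ 0} |p|^{-s}`. -/
def epsteinZeta (L : Set (EuclideanSpace ℝ (Fin 2))) (s : ℝ) : ℝ :=
  ∑' p : ↥(L \ {0}), ‖(p : EuclideanSpace ℝ (Fin 2))‖ ^ (-s)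

/-- The Lennard-Jones type energy `E_f[L] = Σ'_{p ∈ L, p ≠ 0} (a|p|^{-α} - b|p|^{-β})`. -/
def LJenergy (a b α β : ℝ) (L : Set (EuclideanSpace ℝ (Fin 2))) : ℝ :=
  ∑' p : ↥(L \ {0}),
    (a * ‖(p : EuclideanSpace ℝ (Fin 2))‖ ^ (-α) - b * ‖(p : EuclideanSpace ℝ (Fin 2))‖ ^ (-β))

/-- The triangular lattice `A₂ = √(2/√3)·[ℤ(1,0) ⊕ ℤ(1/2,√3/2)]`, of co-volume 1. -/
def triangularLattice : Set (EuclideanSpace ℝ (Fin 2)) :=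
  latticeSet (Real.sqrt (2 / Real.sqrt 3) • vec2 1 0)
    (Real.sqrt (2 / Real.sqrt 3) • vec2 (1 / 2) (Real.sqrt 3 / 2))

/-- The square lattice `ℤ² = ℤ(1,0) ⊕ ℤ(0,1)`. -/
def squareLattice : Set (EuclideanSpace ℝ (Fin 2)) := latticeSet (vec2 1 0) (vec2 0 1)

/-- `L` is the image of `L'` under an orthogonal transformation of ℝ². -/
def IsRotationOf (L L' : Set (EuclideanSpace ℝ (Fin 2))) : Prop :=
  ∃ O : EuclideanSpace ℝ (Fin 2) ≃ₗᵢ[ℝ] EuclideanSpace ℝ (Fin 2), L = O '' L'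

/-- The unit co-volume lattice parametrized by `(x, y)` in the half-fundamental domain:
`ℤu ⊕ ℤv` with `u = (1/√y, 0)` and `v = (x/√y, √y)`. -/
def latticeXY (x y : ℝ) : Set (EuclideanSpace ℝ (Fin 2)) :=
  latticeSet (vec2 (1 / Real.sqrt y) 0) (vec2 (x / Real.sqrt y) (Real.sqrt y))

/-- The Riemann zeta function `ζ(s) = Σ_{m ≥ 1} m^{-s}` (real variable version). -/
def riemannZetaReal (s : ℝ) : ℝ := ∑' n : ℕ+, (n : ℝ) ^ (-s)

end

/-- The lattice point `m u + n v` with integer coordinates `z = (m, n)`. -/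
def latticePoint (u v : EuclideanSpace ℝ (Fin 2)) (z : Fin 2 → ℤ) : EuclideanSpace ℝ (Fin 2) :=
  (z 0 : ℝ) • u + (z 1 : ℝ) • v

lemma latticeSet_eq_range (u v : EuclideanSpace ℝ (Fin 2)) :
    latticeSet u v = Set.range (latticePoint u v) := by
  ext p
  constructor
  · rintro ⟨m, n, rfl⟩
    exact ⟨![m, n], by simp [latticePoint]⟩
  · rintro ⟨z, rfl⟩
    exact ⟨z 0, z 1, rfl⟩

lemma plane_norm_sq (p : EuclideanSpace ℝ (Fin 2)) : ‖p‖ ^ 2 = p 0 ^ 2 + p 1 ^ 2 := by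
  rw [EuclideanSpace.real_norm_sq_eq, Fin.sum_univ_two]

lemma norm_sq_mul_norm_sq_eq (u p : EuclideanSpace ℝ (Fin 2)) :
    ‖u‖ ^ 2 * ‖p‖ ^ 2 = (u 0 * p 0 + u 1 * p 1) ^ 2 + det2 u p ^ 2 := by
  rw [plane_norm_sq, plane_norm_sq, det2]
  ring

lemma abs_det2_le (u p : EuclideanSpace ℝ (Fin 2)) : |det2 u p| ≤ ‖u‖ * ‖p‖ := by
  apply abs_le_of_sq_le_sq _ (by positivity)
  rw [mul_pow, norm_sq_mul_norm_sq_eq]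
  nlinarith [sq_nonneg (u 0 * p 0 + u 1 * p 1)]

lemma det2_latticePoint_left (u v : EuclideanSpace ℝ (Fin 2)) (z : Fin 2 → ℤ) :
    det2 u (latticePoint u v z) = z 1 * det2 u v := by
  simp only [det2, latticePoint, PiLp.add_apply, PiLp.smul_apply, smul_eq_mul]
  ring

lemma det2_latticePoint_right (u v : EuclideanSpace ℝ (Fin 2)) (z : Fin 2 → ℤ) :
    det2 v (latticePoint u v z) = -(z 0 * det2 u v) := by
  simp only [det2, latticePoint, PiLp.add_apply, PiLp.smul_apply, smul_eq_mul]
  ring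

lemma latticePoint_injective {u v : EuclideanSpace ℝ (Fin 2)} (h : det2 u v ≠ 0) :
    Function.Injective (latticePoint u v) := by
  intro z w hzw
  have h1 := det2_latticePoint_left u v z
  have h0 := det2_latticePoint_right u v z
  rw [hzw, det2_latticePoint_left] at h1
  rw [hzw, det2_latticePoint_right, neg_inj] at h0
  have h1' := mul_right_cancel₀ h h1
  have h0' := mul_right_cancel₀ h h0
  ext i
  fin_cases i
  · exact_mod_cast h0'.symm
  · exact_mod_cast h1'.symm

lemma norm_pos_of_det2_ne_zero {u v : EuclideanSpace ℝ (Fin 2)} (h : det2 u v ≠ 0) :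
    0 < ‖u‖ := by
  rw [norm_pos_iff]
  rintro rfl
  simp [det2] at h

lemma mul_norm_le_norm_latticePoint (u v : EuclideanSpace ℝ (Fin 2)) (z : Fin 2 → ℤ) :
    |det2 u v| * ‖z‖ ≤ (‖u‖ + ‖v‖) * ‖latticePoint u v z‖ := by
  have h1 := abs_det2_le u (latticePoint u v z)
  have h0 := abs_det2_le v (latticePoint u v z)
  rw [det2_latticePoint_left, abs_mul] at h1
  rw [det2_latticePoint_right, abs_neg, abs_mul] at h0
  have hu := mul_nonneg (norm_nonneg u) (norm_nonneg (latticePoint u v z))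
  have hv := mul_nonneg (norm_nonneg v) (norm_nonneg (latticePoint u v z))
  have hz : ‖z‖ = ‖z 0‖ ∨ ‖z‖ = ‖z 1‖ := by
    rcases le_total ‖z 0‖ ‖z 1‖ with h | h
    · right
      refine le_antisymm ((pi_norm_le_iff_of_nonneg (norm_nonneg _)).2 fun i ↦ ?_)
        (norm_le_pi_norm z 1)
      fin_cases i <;> simp [h]
    · left
      refine le_antisymm ((pi_norm_le_iff_of_nonneg (norm_nonneg _)).2 fun i ↦ ?_)
        (norm_le_pi_norm z 0)
      fin_cases i <;> simp [h]
  rcases hz with hz | hz <;> rw [hz, Int.norm_eq_abs] <;> linarith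

lemma summable_norm_latticePoint_rpow {u v : EuclideanSpace ℝ (Fin 2)} (h : det2 u v ≠ 0)
    {s : ℝ} (hs : 2 < s) : Summable fun z ↦ ‖latticePoint u v z‖ ^ (-s) := by
  have hu := norm_pos_of_det2_ne_zero h
  have hD : 0 < |det2 u v| := abs_pos.2 h
  have hc : 0 < |det2 u v| / (‖u‖ + ‖v‖) := by positivity
  refine Summable.of_nonneg_of_le (fun z ↦ by positivity) (fun z ↦ ?_)
    ((EisensteinSeries.summable_one_div_norm_rpow hs).mul_left
      ((|det2 u v| / (‖u‖ + ‖v‖)) ^ (-s)))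
  rw [← Real.mul_rpow hc.le (norm_nonneg _)]
  rcases eq_or_ne z 0 with rfl | hz
  · simp [latticePoint]
  · apply Real.rpow_le_rpow_of_nonpos (mul_pos hc (norm_pos_iff.2 hz)) _ (by linarith)
    rw [div_mul_eq_mul_div, div_le_iff₀ (by positivity), mul_comm ‖latticePoint u v z‖]
    exact mul_norm_le_norm_latticePoint u v z

lemma LJenergy_latticeSet (a b : ℝ) {α β : ℝ} (hα : α ≠ 0) (hβ : β ≠ 0)
    {u v : EuclideanSpace ℝ (Fin 2)} (h : det2 u v ≠ 0) :
    LJenergy a b α β (latticeSet u v) =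
      ∑' z, (a * ‖latticePoint u v z‖ ^ (-α) - b * ‖latticePoint u v z‖ ^ (-β)) := by
  rw [← tsum_range (fun p : EuclideanSpace ℝ (Fin 2) ↦ a * ‖p‖ ^ (-α) - b * ‖p‖ ^ (-β))
    (latticePoint_injective h), ← latticeSet_eq_range, LJenergy,
    tsum_subtype (latticeSet u v \ {0})
      (fun p : EuclideanSpace ℝ (Fin 2) ↦ a * ‖p‖ ^ (-α) - b * ‖p‖ ^ (-β)),
    tsum_subtype (latticeSet u v)
      (fun p : EuclideanSpace ℝ (Fin 2) ↦ a * ‖p‖ ^ (-α) - b * ‖p‖ ^ (-β))]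
  congr 1
  ext p
  rcases eq_or_ne p 0 with rfl | hp
  · simp [Set.indicator, Real.zero_rpow, hα, hβ]
  · by_cases hL : p ∈ latticeSet u v
    · have hL' : p ∈ latticeSet u v \ {0} := ⟨hL, hp⟩
      rw [Set.indicator_of_mem hL, Set.indicator_of_mem hL']
    · have hL' : p ∉ latticeSet u v \ {0} := fun h ↦ hL h.1
      rw [Set.indicator_of_notMem hL, Set.indicator_of_notMem hL']

lemma strictMonoOn_lennardJones {a b α β : ℝ} (hβ : 0 < β) (hαβ : β < α) (ha : 0 < a)
    (hb : 0 < b) :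
    StrictMonoOn (fun r : ℝ ↦ a * r ^ (-α) - b * r ^ (-β))
      (Set.Ici ((a * α / (b * β)) ^ (1 / (α - β)))) := by
  have hα : 0 < α := hβ.trans hαβ
  have hq : 0 < a * α / (b * β) := by positivity
  have hr0 : 0 < (a * α / (b * β)) ^ (1 / (α - β)) := by positivity
  have hderiv : ∀ r : ℝ, 0 < r → HasDerivAt (fun r : ℝ ↦ a * r ^ (-α) - b * r ^ (-β))
      (a * (-α * r ^ (-α - 1)) - b * (-β * r ^ (-β - 1))) r := fun r hr ↦
    ((Real.hasDerivAt_rpow_const (Or.inl hr.ne')).const_mul a).sub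
      ((Real.hasDerivAt_rpow_const (Or.inl hr.ne')).const_mul b)
  refine strictMonoOn_of_deriv_pos (convex_Ici _) (fun r hr ↦
    (hderiv r (hr0.trans_le hr)).continuousAt.continuousWithinAt) fun r hr ↦ ?_
  rw [interior_Ici, Set.mem_Ioi] at hr
  have hr' := hr0.trans hr
  rw [(hderiv r hr').deriv]
  have hpow : a * α / (b * β) < r ^ (α - β) := by
    have := Real.rpow_lt_rpow hr0.le hr (sub_pos.2 hαβ)
    rwa [← Real.rpow_mul hq.le, one_div_mul_cancel (sub_pos.2 hαβ).ne', Real.rpow_one] at this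
  rw [div_lt_iff₀ (by positivity)] at hpow
  have hsplit : r ^ (-β - 1) = r ^ (α - β) * r ^ (-α - 1) := by
    rw [← Real.rpow_add hr']
    ring_nf
  rw [hsplit]
  nlinarith [mul_lt_mul_of_pos_right hpow (Real.rpow_pos_of_pos hr' (-α - 1))]

/-- Moving lattice points towards the origin, but not closer than the minimum of the potential,
decreases the Lennard-Jones energy. -/
lemma LJenergy_lt_of_norm_lt {a b α β : ℝ} (hβ : 2 < β) (hαβ : β < α) (ha : 0 < a) (hb : 0 < b)
    {u v u' v' : EuclideanSpace ℝ (Fin 2)} (h : det2 u v ≠ 0) (h' : det2 u' v' ≠ 0)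
    (hle : ∀ z, ‖latticePoint u' v' z‖ = ‖latticePoint u v z‖ ∨
      (a * α / (b * β)) ^ (1 / (α - β)) ≤ ‖latticePoint u' v' z‖ ∧
        ‖latticePoint u' v' z‖ < ‖latticePoint u v z‖)
    (hlt : ∃ z, ‖latticePoint u' v' z‖ < ‖latticePoint u v z‖) :
    LJenergy a b α β (latticeSet u' v') < LJenergy a b α β (latticeSet u v) := by
  have hα : 2 < α := hβ.trans hαβ
  rw [LJenergy_latticeSet a b (by linarith) (by linarith) h,
    LJenergy_latticeSet a b (by linarith) (by linarith) h']
  have hmono := strictMonoOn_lennardJones (zero_lt_two.trans hβ) hαβ ha hb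
  have key : ∀ z, ‖latticePoint u' v' z‖ < ‖latticePoint u v z‖ →
      a * ‖latticePoint u' v' z‖ ^ (-α) - b * ‖latticePoint u' v' z‖ ^ (-β) <
        a * ‖latticePoint u v z‖ ^ (-α) - b * ‖latticePoint u v z‖ ^ (-β) := by
    intro z hz
    rcases hle z with heq | ⟨h1, h2⟩
    · exact absurd heq hz.ne
    · exact hmono h1 (h1.trans h2.le) h2
  obtain ⟨z₀, hz₀⟩ := hlt
  refine Summable.tsum_lt_tsum (i := z₀) (fun z ↦ ?_) (key z₀ hz₀)
    (((summable_norm_latticePoint_rpow h' hα).mul_left a).sub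
      ((summable_norm_latticePoint_rpow h' hβ).mul_left b))
    (((summable_norm_latticePoint_rpow h hα).mul_left a).sub
      ((summable_norm_latticePoint_rpow h hβ).mul_left b))
  rcases hle z with heq | ⟨-, h2⟩
  · rw [heq]
  · exact (key z h2).le

/-- If the lattice rows parallel to `u` are further apart than the minimum of the potential, then
contracting the plane orthogonally to `u` decreases the Lennard-Jones energy. -/
lemma exists_LJenergy_lt_of_mul_norm_lt {a b α β : ℝ} (hβ : 2 < β) (hαβ : β < α) (ha : 0 < a)
    (hb : 0 < b) {u v : EuclideanSpace ℝ (Fin 2)}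
    (h : (a * α / (b * β)) ^ (1 / (α - β)) * ‖u‖ < |det2 u v|) :
    ∃ L, IsLattice2 L ∧ LJenergy a b α β L < LJenergy a b α β (latticeSet u v) := by
  have hq : 0 < a * α / (b * β) := by
    have : 0 < α := by linarith
    positivity
  have hr0 : 0 < (a * α / (b * β)) ^ (1 / (α - β)) := by positivity
  set r := (a * α / (b * β)) ^ (1 / (α - β))
  have hV : 0 < |det2 u v| := (by positivity : (0 : ℝ) ≤ r * ‖u‖).trans_lt h
  have hD : det2 u v ≠ 0 := abs_pos.1 hV
  have hu := norm_pos_of_det2_ne_zero hD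
  have hu2 : u 0 ^ 2 + u 1 ^ 2 ≠ 0 := by
    rw [← plane_norm_sq]
    positivity
  set t := r * ‖u‖ / |det2 u v| with ht
  have ht0 : 0 < t := by positivity
  have ht1 : t < 1 := (div_lt_one hV).2 h
  set v' := v - ((1 - t) * det2 u v / (u 0 ^ 2 + u 1 ^ 2)) • vec2 (-u 1) (u 0) with hv'
  have hv0 : v' 0 = v 0 + ((1 - t) * det2 u v / (u 0 ^ 2 + u 1 ^ 2)) * u 1 := by
    simp [hv', vec2]
  have hv1 : v' 1 = v 1 - ((1 - t) * det2 u v / (u 0 ^ 2 + u 1 ^ 2)) * u 0 := by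
    simp [hv', vec2]
  have hdet : det2 u v' = t * det2 u v := by
    have : det2 u v' = det2 u v -
        ((1 - t) * det2 u v / (u 0 ^ 2 + u 1 ^ 2)) * (u 0 ^ 2 + u 1 ^ 2) := by
      rw [det2, hv0, hv1, det2]
      ring
    rw [this, div_mul_cancel₀ _ hu2]
    ring
  have hinner : ∀ z, u 0 * latticePoint u v' z 0 + u 1 * latticePoint u v' z 1 =
      u 0 * latticePoint u v z 0 + u 1 * latticePoint u v z 1 := by
    intro z
    simp only [latticePoint, PiLp.add_apply, PiLp.smul_apply, smul_eq_mul, hv0, hv1]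
    ring
  have hsq : ∀ z, ‖u‖ ^ 2 * ‖latticePoint u v z‖ ^ 2 - ‖u‖ ^ 2 * ‖latticePoint u v' z‖ ^ 2 =
      (1 - t ^ 2) * ((z 1 : ℝ) * det2 u v) ^ 2 := by
    intro z
    rw [norm_sq_mul_norm_sq_eq, norm_sq_mul_norm_sq_eq, hinner, det2_latticePoint_left,
      det2_latticePoint_left, hdet]
    ring
  have hlt : ∀ z : Fin 2 → ℤ, z 1 ≠ 0 → ‖latticePoint u v' z‖ < ‖latticePoint u v z‖ := by
    intro z hz
    have hz' : (z 1 : ℝ) ≠ 0 := by exact_mod_cast hz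
    have hpos : 0 < (1 - t ^ 2) * ((z 1 : ℝ) * det2 u v) ^ 2 := by
      have : 0 < 1 - t ^ 2 := by nlinarith
      positivity
    rw [← hsq, ← mul_sub] at hpos
    have := pos_of_mul_pos_right hpos (by positivity)
    exact lt_of_pow_lt_pow_left₀ 2 (norm_nonneg _) (by linarith)
  have hD' : det2 u v' ≠ 0 := by
    rw [hdet]
    exact mul_ne_zero ht0.ne' hD
  refine ⟨latticeSet u v', ⟨u, v', hD', rfl⟩,
    LJenergy_lt_of_norm_lt hβ hαβ ha hb hD hD' (fun z ↦ ?_) ⟨![0, 1], hlt _ (by simp)⟩⟩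
  by_cases hz : z 1 = 0
  · left
    simp [latticePoint, hz]
  · refine Or.inr ⟨?_, hlt z hz⟩
    have h1 := abs_det2_le u (latticePoint u v' z)
    rw [det2_latticePoint_left, hdet, abs_mul, abs_mul, abs_of_pos ht0, ht,
      div_mul_cancel₀ _ hV.ne'] at h1
    have hz1 : (1 : ℝ) ≤ |(z 1 : ℝ)| := by exact_mod_cast Int.one_le_abs hz
    have h2 : r * ‖u‖ ≤ |(z 1 : ℝ)| * (r * ‖u‖) := le_mul_of_one_le_left (by positivity) hz1
    exact le_of_mul_le_mul_left (by linarith) hu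

/-- Every nonzero lattice point is at least as long as the first vector of some basis of the
lattice. -/
lemma exists_basis_norm_le (u v : EuclideanSpace ℝ (Fin 2)) {z : Fin 2 → ℤ} (hz : z ≠ 0) :
    ∃ u' v', latticeSet u' v' = latticeSet u v ∧ det2 u' v' = det2 u v ∧
      ‖u'‖ ≤ ‖latticePoint u v z‖ := by
  have hg : 0 < Int.gcd (z 0) (z 1) := by
    rw [Int.gcd_pos_iff]
    by_contra! hcon
    exact hz (by ext i; fin_cases i <;> simp [hcon])
  obtain ⟨g, m, n, hgpos, hmn, h0, h1⟩ := Int.exists_gcd_one' hg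
  obtain ⟨s, t, hst⟩ := Int.isCoprime_iff_gcd_eq_one.2 hmn
  have hstR : (s : ℝ) * m + t * n = 1 := by exact_mod_cast hst
  refine ⟨(m : ℝ) • u + (n : ℝ) • v, (-t : ℝ) • u + (s : ℝ) • v, ?_, ?_, ?_⟩
  · ext p
    constructor
    · rintro ⟨k, l, rfl⟩
      refine ⟨k * m - l * t, k * n + l * s, ?_⟩
      push_cast
      module
    · rintro ⟨k, l, rfl⟩
      refine ⟨k * s + l * t, l * m - k * n, ?_⟩
      push_cast
      have e : (k : ℝ) • u + (l : ℝ) • v =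
          ((k : ℝ) * (s * m + t * n)) • u + ((l : ℝ) * (s * m + t * n)) • v := by
        rw [hstR, mul_one, mul_one]
      rw [e]
      module
  · simp only [det2, PiLp.add_apply, PiLp.smul_apply, smul_eq_mul]
    linear_combination (u 0 * v 1 - u 1 * v 0) * hstR
  · have e : latticePoint u v z = (g : ℝ) • ((m : ℝ) • u + (n : ℝ) • v) := by
      rw [latticePoint, h0, h1]
      push_cast
      module
    rw [e, norm_smul, Real.norm_natCast]
    exact le_mul_of_one_le_left (norm_nonneg _) (by exact_mod_cast hgpos)

/-- If all nonzero lattice points are uniformly further from the origin than the minimum of the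
potential, then shrinking the lattice decreases the Lennard-Jones energy. -/
lemma exists_LJenergy_lt_of_lt_norm {a b α β : ℝ} (hβ : 2 < β) (hαβ : β < α) (ha : 0 < a)
    (hb : 0 < b) {u v : EuclideanSpace ℝ (Fin 2)} (hD : det2 u v ≠ 0) {ρ : ℝ}
    (hρ : (a * α / (b * β)) ^ (1 / (α - β)) < ρ)
    (h : ∀ z ≠ 0, ρ ≤ ‖latticePoint u v z‖) :
    ∃ L, IsLattice2 L ∧ LJenergy a b α β L < LJenergy a b α β (latticeSet u v) := by
  have hq : 0 < a * α / (b * β) := by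
    have : 0 < α := by linarith
    positivity
  have hr : 0 < (a * α / (b * β)) ^ (1 / (α - β)) := by positivity
  set r := (a * α / (b * β)) ^ (1 / (α - β)) with hrdef
  have hρ0 : 0 < ρ := hr.trans hρ
  have ht0 : 0 < r / ρ := by positivity
  have ht1 : r / ρ < 1 := (div_lt_one hρ0).2 hρ
  have hD' : det2 ((r / ρ) • u) ((r / ρ) • v) ≠ 0 := by
    have : det2 ((r / ρ) • u) ((r / ρ) • v) = (r / ρ) ^ 2 * det2 u v := by
      simp only [det2, PiLp.smul_apply, smul_eq_mul]
      ring
    rw [this]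
    exact mul_ne_zero (by positivity) hD
  have hnorm : ∀ z, ‖latticePoint ((r / ρ) • u) ((r / ρ) • v) z‖ =
      r / ρ * ‖latticePoint u v z‖ := by
    intro z
    rw [← abs_of_pos ht0, ← Real.norm_eq_abs, ← norm_smul, Real.norm_eq_abs, abs_of_pos ht0]
    congr 1
    simp only [latticePoint]
    module
  have hlt : ∀ z ≠ 0, ‖latticePoint ((r / ρ) • u) ((r / ρ) • v) z‖ < ‖latticePoint u v z‖ :=
    fun z hz ↦ (hnorm z).trans_lt (mul_lt_of_lt_one_left (hρ0.trans_le (h z hz)) ht1)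
  refine ⟨_, ⟨_, _, hD', rfl⟩, LJenergy_lt_of_norm_lt hβ hαβ ha hb hD hD' (fun z ↦ ?_)
    ⟨fun _ ↦ 1, hlt _ fun h ↦ one_ne_zero (congrFun h 0)⟩⟩
  rcases eq_or_ne z 0 with rfl | hz
  · left
    simp [latticePoint]
  · refine Or.inr ⟨?_, hlt z hz⟩
    rw [hnorm, ← hrdef, div_mul_eq_mul_div, le_div_iff₀ hρ0]
    exact mul_le_mul_of_nonneg_left (h z hz) hr.le

/-- Any global minimizer `L₀` of a Lennard-Jones type energy among all two-dimensional
lattices has co-volume `V_{L₀}` satisfying `0 < V_{L₀} ≤ (aα/(bβ))^{2/(α-β)}`. -/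
theorem covolume_bound_of_global_minimizer
    (α β a b : ℝ) (hβ : 2 < β) (hαβ : β < α) (ha : 0 < a) (hb : 0 < b)
    (L₀ : Set (EuclideanSpace ℝ (Fin 2))) (V₀ : ℝ) (hL₀ : IsLattice2OfCovol L₀ V₀)
    (hmin : ∀ L : Set (EuclideanSpace ℝ (Fin 2)), IsLattice2 L →
      LJenergy a b α β L₀ ≤ LJenergy a b α β L) :
    0 < V₀ ∧ V₀ ≤ (a * α / (b * β)) ^ (2 / (α - β)) := by
  obtain ⟨u, v, hD, rfl, rfl⟩ := hL₀
  refine ⟨abs_pos.2 hD, ?_⟩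
  by_contra! hV
  have hq : 0 < a * α / (b * β) := by
    have : 0 < α := by linarith
    positivity
  have hr : 0 < (a * α / (b * β)) ^ (1 / (α - β)) := by positivity
  have hrr : (a * α / (b * β)) ^ (2 / (α - β)) =
      (a * α / (b * β)) ^ (1 / (α - β)) * (a * α / (b * β)) ^ (1 / (α - β)) := by
    rw [← Real.rpow_add hq, ← add_div, one_add_one_eq_two]
  have hsqrt := Real.mul_self_sqrt (abs_nonneg (det2 u v))
  have hlt : (a * α / (b * β)) ^ (1 / (α - β)) < √|det2 u v| := by
    apply Real.lt_sqrt_of_sq_lt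
    rwa [sq, ← hrr]
  suffices ∃ L, IsLattice2 L ∧ LJenergy a b α β L < LJenergy a b α β (latticeSet u v) by
    obtain ⟨L, hL, hE⟩ := this
    exact (hmin L hL).not_gt hE
  by_cases hshort : ∃ z ≠ 0, ‖latticePoint u v z‖ < √|det2 u v|
  · obtain ⟨z, hz, hzlt⟩ := hshort
    obtain ⟨u', v', hL, hdet, hu'⟩ := exists_basis_norm_le u v hz
    rw [← hL]
    apply exists_LJenergy_lt_of_mul_norm_lt hβ hαβ ha hb
    rw [hdet, ← hsqrt]
    exact mul_lt_mul'' hlt (hu'.trans_lt hzlt) hr.le (norm_nonneg _)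
  · push Not at hshort
    exact exists_LJenergy_lt_of_lt_norm hβ hαβ ha hb hD hlt hshort
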